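/- Let λ be a Borel measure on ℝ with uncountable support such that ∫ min(x², 1) dλ(x) < ∞, and define C(t) := (∫ 4 sin²(tx/2) dλ(x))^{1/2} for t ≥ 0. For real numbers m, m' with m ≠ 0, m' ≠ 0 and m + m' ≠ 0, define h(m, m') := π − θ(m, m'), where θ(m, m') ∈ [0, π] is determined by cos θ(m, m') = (C(|m|)² + C(|m'|)² − C(|m + m'|)²) / (2 · C(|m|) · C(|m'|)) (this is well defined since C(|m|), C(|m'|) > 0 and the quotient lies in (−1, 1)). Let k ≥ 4 and let m₁, …, m_k be nonzero reals with m₁ + ⋯ + m_k = 0 and m_j + m_{j+1} ≠ 0 for all j (indices modulo k, so m_{k+1} = m₁). Then h(m₁, m₂) + h(m₂, m₃) + ⋯ + h(m_{k−1}, m_k) + h(m_k, m₁) > 2π. -/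

import Mathlib

open Real MeasureTheory

/-- The topological support of a measure on `ℝ`: all points every open
neighbourhood of which has positive measure. -/
def measureSupport (μ : MeasureTheory.Measure ℝ) : Set ℝ :=
  {x : ℝ | ∀ U : Set ℝ, IsOpen U → x ∈ U → μ U ≠ 0}

/-- An admissible cost function: `C(t) = (∫ 4 sin²(tx/2) dλ(x))^{1/2}`. -/
noncomputable def admissibleCost (lam : MeasureTheory.Measure ℝ) (t : ℝ) : ℝ :=
  Real.sqrt (∫ x, 4 * Real.sin (t * x / 2) ^ 2 ∂lam)

/-- The outer angle `h(m, m') = π − θ(m, m')`, where `θ(m, m')` is the interior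
angle between the sides of lengths `C(|m|)` and `C(|m'|)` in the triangle with
side lengths `C(|m|)`, `C(|m'|)`, `C(|m + m'|)`, given by the law of cosines. -/
noncomputable def outerAngle (lam : MeasureTheory.Measure ℝ) (m m' : ℝ) : ℝ :=
  π - Real.arccos ((admissibleCost lam |m| ^ 2 + admissibleCost lam |m'| ^ 2
      - admissibleCost lam |m + m'| ^ 2)
    / (2 * admissibleCost lam |m| * admissibleCost lam |m'|))

open EuclideanGeometry in
/-- In an affinely independent quadruple `p`, `q`, `r`, `s`, the triangle inequality for the angles
at the apex `s` is strict. -/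
lemma angle_lt_angle_add_angle_of_affineIndependent {V : Type*} [NormedAddCommGroup V]
    [InnerProductSpace ℝ V] {p q r s : V} (h : AffineIndependent ℝ ![p, q, r, s]) :
    ∠ p s r < ∠ p s q + ∠ q s r := by
  have key : ∀ a b c : ℝ, a • (p - s) + b • (q - s) + c • (r - s) = 0 →
      a = 0 ∧ b = 0 ∧ c = 0 := by
    intro a b c habc
    have hw := affineIndependent_iff.1 h Finset.univ ![a, b, c, -(a + b + c)]
      (by simp [Fin.sum_univ_four]) (by
        rw [← habc]
        simp [Fin.sum_univ_four]
        module)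
    exact ⟨hw 0 (by simp), hw 1 (by simp), hw 2 (by simp)⟩
  refine lt_of_le_of_ne (angle_le_angle_add_angle _ _ _ _) fun heq => ?_
  have hy : q -ᵥ s ≠ 0 := fun h0 => by
    have := key 0 1 0 (by simpa using h0)
    simp at this
  rcases (InnerProductGeometry.angle_eq_angle_add_angle_iff hy).1 heq with h1 | h1
  · obtain ⟨-, t, -, ht⟩ := InnerProductGeometry.angle_eq_pi_iff.1 h1
    have := key (-t) 0 1 (by simp only [vsub_eq_sub] at ht; rw [ht]; module)
    simp at this
  · obtain ⟨a, b, hab⟩ := Submodule.mem_span_pair.1 h1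
    have := key a (-1) b (by
      simp only [vsub_eq_sub, NNReal.smul_def] at hab
      rw [← hab]; module)
    simp at this

open EuclideanGeometry in
/-- The interior angles of a closed polygon whose vertices lie on an affinely independent curve
`φ` have sum smaller than in a planar convex polygon. -/
lemma sum_angle_lt_of_affineIndependent {V : Type*} [NormedAddCommGroup V]
    [InnerProductSpace ℝ V] {ι : Type*} {φ : ι → V} (hφ : AffineIndependent ℝ φ)
    {p : ℕ → ι} (h₁ : ∀ j, p j ≠ p (j + 1)) (h₂ : ∀ j, p j ≠ p (j + 2)) (n : ℕ) :
    ∑ j ∈ Finset.range (n + 2), ∠ (φ (p j)) (φ (p (j + 1))) (φ (p (j + 2)))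
      + ∠ (φ (p (n + 2))) (φ (p (n + 3))) (φ (p 0))
      + ∠ (φ (p 1)) (φ (p 0)) (φ (p (n + 3))) < (n + 2) * π := by
  have hne : ∀ j, φ (p (j + 1)) ≠ φ (p j) := fun j h => h₁ j (hφ.injective h).symm
  induction n with
  | zero =>
    simp only [zero_add, Finset.sum_range_succ, Finset.sum_range_zero, Nat.cast_zero,
      Nat.reduceAdd]
    have t₁ := angle_add_angle_add_angle_eq_pi (φ (p 2)) (hne 0)
    have c := angle_comm (φ (p 2)) (φ (p 0)) (φ (p 1))
    by_cases h30 : p 3 = p 0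
    · have hnc : ¬ Collinear ℝ {φ (p 1), φ (p 0), φ (p 2)} := by
        rw [← affineIndependent_iff_not_collinear_set]
        have hinj : Function.Injective ![p 1, p 0, p 2] := by
          have e₀ := h₁ 0
          have e₁ := h₁ 1
          have e₂ := h₂ 0
          clear * - e₀ e₁ e₂
          intro i j hij
          fin_cases i <;> fin_cases j <;> simp_all [eq_comm]
        have hcomp : φ ∘ ![p 1, p 0, p 2] = ![φ (p 1), φ (p 0), φ (p 2)] := by
          funext i
          fin_cases i <;> rfl
        exact hcomp ▸ hφ.comp_embedding ⟨_, hinj⟩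
      have hpos := angle_pos_of_not_collinear hnc
      simp only [h30, EuclideanGeometry.angle_self_right]
      linarith
    · have hind : AffineIndependent ℝ ![φ (p 1), φ (p 0), φ (p 3), φ (p 2)] := by
        have hinj : Function.Injective ![p 1, p 0, p 3, p 2] := by
          have e₀ := h₁ 0
          have e₁ := h₁ 1
          have e₂ := h₁ 2
          have e₃ := h₂ 0
          have e₄ := h₂ 1
          clear * - e₀ e₁ e₂ e₃ e₄ h30
          intro i j hij
          fin_cases i <;> fin_cases j <;> simp_all [eq_comm]
        have hcomp : φ ∘ ![p 1, p 0, p 3, p 2] = ![φ (p 1), φ (p 0), φ (p 3), φ (p 2)] := by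
          funext i
          fin_cases i <;> rfl
        exact hcomp ▸ hφ.comp_embedding ⟨_, hinj⟩
      have hlt := angle_lt_angle_add_angle_of_affineIndependent hind
      have t₂ := angle_add_angle_add_angle_eq_pi (φ (p 0)) (hne 2)
      have hle := angle_le_angle_add_angle (φ (p 0)) (φ (p 1)) (φ (p 2)) (φ (p 3))
      have c₁ := angle_comm (φ (p 0)) (φ (p 2)) (φ (p 1))
      have c₂ := angle_comm (φ (p 0)) (φ (p 2)) (φ (p 3))
      have c₃ := angle_comm (φ (p 0)) (φ (p 3)) (φ (p 2))
      have c₄ := angle_comm (φ (p 2)) (φ (p 0)) (φ (p 3))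
      linarith
  | succ n ih =>
    rw [Finset.sum_range_succ]
    have t := angle_add_angle_add_angle_eq_pi (φ (p 0)) (hne (n + 3))
    have hle₁ := angle_le_angle_add_angle (φ (p (n + 3))) (φ (p (n + 2))) (φ (p 0)) (φ (p (n + 4)))
    have hle₂ := angle_le_angle_add_angle (φ (p 0)) (φ (p 1)) (φ (p (n + 3))) (φ (p (n + 4)))
    have c₁ := angle_comm (φ (p 0)) (φ (p (n + 4))) (φ (p (n + 3)))
    have c₂ := angle_comm (φ (p 0)) (φ (p (n + 3))) (φ (p (n + 4)))
    have c₃ := angle_comm (φ (p (n + 4))) (φ (p 0)) (φ (p (n + 3)))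
    push_cast
    simp only [Nat.add_assoc, Nat.reduceAdd] at *
    linarith

/-- A real-analytic function that vanishes almost everywhere for a measure with uncountable support
is identically zero. -/
lemma eq_zero_of_ae_eq_zero_of_uncountable_support {lam : Measure ℝ}
    (hunc : ¬ (measureSupport lam).Countable) {g : ℝ → ℂ}
    (hg : AnalyticOnNhd ℝ g Set.univ) (h0 : ∀ᵐ x ∂lam, g x = 0) (x : ℝ) : g x = 0 := by
  by_contra hx
  have hcod := hg.preimage_zero_mem_codiscrete hx
  refine hunc (Set.Countable.mono (s₂ := (g ⁻¹' {0}ᶜ)ᶜ) (fun y hy => ?_) ?_)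
  · simp only [Set.mem_compl_iff, Set.mem_preimage, Set.mem_singleton_iff, not_not]
    by_contra hgy
    have hcont : Continuous g := continuousOn_univ.1 hg.continuousOn
    exact hy {z | g z ≠ 0} (isOpen_ne_fun hcont continuous_const) hgy h0
  · have := mem_codiscrete_accPt.1 hcod
    have hd : DiscreteTopology ↥(g ⁻¹' {0}ᶜ)ᶜ := discreteTopology_of_noAccPts fun x _ => this x
    exact Set.countable_coe_iff.1
      (TopologicalSpace.separableSpace_iff_countable.1 inferInstance)

/-- The function `x ↦ exp (i p x) - 1`. -/
noncomputable def expCurveFun (p x : ℝ) : ℂ := Complex.exp (Complex.I * (p * x : ℝ)) - 1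

lemma continuous_expCurveFun (p : ℝ) : Continuous (expCurveFun p) := by
  unfold expCurveFun; fun_prop

lemma norm_expCurveFun_sub_sq (p q x : ℝ) :
    ‖expCurveFun p x - expCurveFun q x‖ ^ 2 = 4 * Real.sin (|p - q| * x / 2) ^ 2 := by
  have h : expCurveFun p x - expCurveFun q x =
      Complex.exp (Complex.I * (q * x : ℝ)) *
        (Complex.exp (Complex.I * ((p - q) * x : ℝ)) - 1) := by
    rw [mul_sub, ← Complex.exp_add, expCurveFun, expCurveFun]
    push_cast
    ring_nf
  rw [h, norm_mul, Complex.norm_exp_I_mul_ofReal, Complex.norm_exp_I_mul_ofReal_sub_one, one_mul,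
    Real.norm_eq_abs, sq_abs, mul_pow]
  rcases abs_choice (p - q) with h' | h' <;> rw [h']
  · norm_num
  · rw [neg_mul, neg_div, Real.sin_neg]; norm_num

lemma memLp_expCurveFun {lam : Measure ℝ}
    (hint : Integrable (fun x : ℝ => min (x ^ 2) 1) lam) (p : ℝ) :
    MemLp (expCurveFun p) 2 lam := by
  have hm := (continuous_expCurveFun p).aestronglyMeasurable (μ := lam)
  rw [memLp_two_iff_integrable_sq_norm hm]
  refine (hint.const_mul (p ^ 2 + 4)).mono' (hm.norm.pow 2) (.of_forall fun x => ?_)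
  have h1 : ‖expCurveFun p x‖ ≤ ‖p * x‖ := Real.norm_exp_I_mul_ofReal_sub_one_le
  have h2 : ‖expCurveFun p x‖ ≤ 2 := by
    refine (norm_sub_le _ _).trans ?_
    rw [Complex.norm_exp_I_mul_ofReal]; norm_num
  have h0 := norm_nonneg (expCurveFun p x)
  rw [Real.norm_of_nonneg (by positivity)]
  rcases le_total (x ^ 2) 1 with h | h
  · rw [min_eq_left h]
    have := pow_le_pow_left₀ h0 h1 2
    rw [Real.norm_eq_abs, sq_abs] at this
    nlinarith [sq_nonneg x]
  · rw [min_eq_right h]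
    nlinarith [sq_nonneg p]

/-- The curve `p ↦ (x ↦ exp (i p x) - 1)` in the Hilbert space `L²(λ)`. -/
noncomputable def expCurve {lam : Measure ℝ}
    (hint : Integrable (fun x : ℝ => min (x ^ 2) 1) lam) (p : ℝ) : Lp ℂ 2 lam :=
  (memLp_expCurveFun hint p).toLp _

lemma norm_expCurve_sub {lam : Measure ℝ}
    (hint : Integrable (fun x : ℝ => min (x ^ 2) 1) lam) (p q : ℝ) :
    ‖expCurve hint p - expCurve hint q‖ = admissibleCost lam |p - q| := by
  rw [expCurve, expCurve, ← MemLp.toLp_sub, admissibleCost]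
  refine (Real.sqrt_eq_iff_mul_self_eq (integral_nonneg fun x => by positivity)
    (norm_nonneg _)).2 ?_ |>.symm
  rw [← real_inner_self_eq_norm_mul_norm, L2.inner_def]
  refine integral_congr_ae ?_
  filter_upwards [((memLp_expCurveFun hint p).sub (memLp_expCurveFun hint q)).coeFn_toLp] with x hx
  rw [hx, real_inner_self_eq_norm_sq, Pi.sub_apply, norm_expCurveFun_sub_sq]

lemma linearIndependent_exp_mul_I :
    LinearIndependent ℂ fun p x : ℝ => Complex.exp (Complex.I * (p * x : ℝ)) := by
  let χ : ℝ → (Multiplicative ℝ →* ℂ) := fun p =>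
    { toFun := fun x => Complex.exp (Complex.I * (p * x.toAdd : ℝ))
      map_one' := by simp
      map_mul' := fun x y => by
        rw [← Complex.exp_add]; simp only [toAdd_mul]; push_cast; ring_nf }
  have hχ : Function.Injective χ := by
    intro p q hpq
    by_contra hne
    have h := DFunLike.congr_fun hpq (Multiplicative.ofAdd (π / (p - q)))
    have h' : expCurveFun p (π / (p - q)) - expCurveFun q (π / (p - q)) = 0 := by
      unfold expCurveFun
      rw [sub_sub_sub_cancel_right, sub_eq_zero]
      exact h
    have h2 := norm_expCurveFun_sub_sq p q (π / (p - q))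
    have hne' : p - q ≠ 0 := sub_ne_zero.2 hne
    rw [h'] at h2
    have h3 : Real.sin ((p - q) * (π / (p - q)) / 2) = 1 := by
      rw [mul_div_cancel₀ _ hne', Real.sin_pi_div_two]
    rcases abs_choice (p - q) with ha | ha <;> rw [ha] at h2
    · rw [h3] at h2; norm_num at h2
    · rw [neg_mul, neg_div, Real.sin_neg, h3] at h2; norm_num at h2
  exact (linearIndependent_monoidHom (Multiplicative ℝ) ℂ).comp χ hχ

/-- Distinct points of the curve `expCurve` are affinely independent. -/
lemma affineIndependent_expCurve {lam : Measure ℝ}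
    (hunc : ¬ (measureSupport lam).Countable)
    (hint : Integrable (fun x : ℝ => min (x ^ 2) 1) lam) :
    AffineIndependent ℝ (expCurve hint) := by
  rw [affineIndependent_iff]
  intro s w hw hsum
  have hae : ∀ᵐ x ∂lam, ∑ p ∈ s, (w p : ℂ) * Complex.exp (Complex.I * (p * x : ℝ)) = 0 := by
    have hz : (∑ p ∈ s, w p • expCurve hint p : Lp ℂ 2 lam) =ᵐ[lam] 0 := by
      rw [hsum]; exact Lp.coeFn_zero _ _ _
    have hs : ∀ᵐ x ∂lam, ∀ p ∈ s, (w p • expCurve hint p : Lp ℂ 2 lam) x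
        = w p • expCurveFun p x := by
      refine (Finset.eventually_all s).2 fun p _ => ?_
      filter_upwards [Lp.coeFn_smul (w p) (expCurve hint p),
        (memLp_expCurveFun hint p).coeFn_toLp] with x h1 h2
      rw [h1, Pi.smul_apply, expCurve, h2]
    have hl := Lp.coeFn_finsetSum s (fun p => w p • expCurve hint p)
    filter_upwards [hz, hs, hl] with x hx1 hx2 hx3
    rw [hx1, Finset.sum_apply, Finset.sum_congr rfl hx2] at hx3
    have hw' : ∑ p ∈ s, (w p : ℂ) = 0 := by exact_mod_cast hw
    simpa [expCurveFun, mul_sub, hw'] using hx3.symm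
  have hall := eq_zero_of_ae_eq_zero_of_uncountable_support hunc
    (g := fun x => ∑ p ∈ s, (w p : ℂ) * Complex.exp (Complex.I * (p * x : ℝ))) (fun x _ =>
      Finset.analyticAt_fun_sum s fun p _ => analyticAt_const.mul <|
        (analyticAt_cexp.restrictScalars (𝕜 := ℝ)).comp <| analyticAt_const.mul <|
          (Complex.ofRealCLM.analyticAt _).comp (analyticAt_const.mul analyticAt_id)) hae
  intro p hp
  have := linearIndependent_iff'.1 linearIndependent_exp_mul_I s (fun p => (w p : ℂ))
    (by ext x; simpa using hall x) p hp
  exact_mod_cast this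

open EuclideanGeometry in
/-- The outer angle is the exterior angle of the polygonal line through three points of the curve
`expCurve`. -/
lemma outerAngle_eq_pi_sub_angle {lam : Measure ℝ}
    (hint : Integrable (fun x : ℝ => min (x ^ 2) 1) lam) (p a b : ℝ) :
    outerAngle lam a b =
      π - ∠ (expCurve hint p) (expCurve hint (p + a)) (expCurve hint (p + a + b)) := by
  set A := expCurve hint p
  set B := expCurve hint (p + a)
  set C := expCurve hint (p + a + b)
  have h1 : admissibleCost lam |a| = ‖A - B‖ := by
    rw [norm_sub_rev, norm_expCurve_sub]; congr 2; ring
  have h2 : admissibleCost lam |b| = ‖C - B‖ := by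
    rw [norm_expCurve_sub]; congr 2; ring
  have h3 : admissibleCost lam |a + b| = ‖(A - B) - (C - B)‖ := by
    rw [sub_sub_sub_cancel_right, norm_sub_rev, norm_expCurve_sub]; congr 2; ring
  rw [outerAngle, h1, h2, h3, EuclideanGeometry.angle, InnerProductGeometry.angle]
  simp only [vsub_eq_sub]
  rw [norm_sub_sq_real (A - B) (C - B), mul_assoc, ← mul_div_mul_left _ (‖A - B‖ * ‖C - B‖)
    (two_ne_zero (α := ℝ))]
  ring_nf

/-- **Theorem.** For an admissible cost function coming from a Borel measure
`λ` on `ℝ` with uncountable support and `∫ min(x², 1) dλ < ∞`, and nonzero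
masses `m₁, …, m_k` (`k ≥ 4`, indices cyclic) with zero total sum and with
`m_j + m_{j+1} ≠ 0` for all `j`, the sum of the outer angles
`h(m_j, m_{j+1})` is strictly greater than `2π`. -/
theorem sum_outer_angles_gt_two_pi
    (lam : Measure ℝ)
    (hunc : ¬ (measureSupport lam).Countable)
    (hint : Integrable (fun x : ℝ => min (x ^ 2) 1) lam)
    (k : ℕ) (hk : 4 ≤ k) (m : ℕ → ℝ)
    (hper : ∀ j, m (j + k) = m j)
    (hm : ∀ j, m j ≠ 0)
    (hsum : ∑ j ∈ Finset.range k, m j = 0)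
    (hpair : ∀ j, m j + m (j + 1) ≠ 0) :
    2 * π < ∑ j ∈ Finset.range k, outerAngle lam (m j) (m (j + 1)) := by
  obtain ⟨n, rfl⟩ : ∃ n, k = n + 4 := ⟨k - 4, by omega⟩
  let p : ℕ → ℝ := fun j => ∑ i ∈ Finset.range j, m i
  have hp : ∀ j, p (j + 1) = p j + m j := fun j => Finset.sum_range_succ _ _
  have hp0 : p 0 = 0 := by simp [p]
  have hpk : p (n + 4) = p 0 := by rw [hp0]; exact hsum
  have hpk1 : p (n + 5) = p 1 := by
    have := hper 0
    rw [zero_add] at this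
    rw [hp (n + 4), hp 0, hpk, this]
  have hlt := sum_angle_lt_of_affineIndependent (affineIndependent_expCurve hunc hint) (p := p)
    (fun j h => hm j (by linarith [hp j]))
    (fun j h => hpair j (by linarith [hp j, hp (j + 1)])) n
  have hout : ∀ j, outerAngle lam (m j) (m (j + 1)) = π - EuclideanGeometry.angle
      (expCurve hint (p j)) (expCurve hint (p (j + 1))) (expCurve hint (p (j + 2))) := fun j => by
    rw [outerAngle_eq_pi_sub_angle hint (p j), ← hp, ← hp]
  rw [Finset.sum_congr rfl fun j _ => hout j, Finset.sum_sub_distrib, Finset.sum_const,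
    Finset.card_range, nsmul_eq_mul, Finset.sum_range_succ, Finset.sum_range_succ,
    show n + 3 + 1 = n + 4 from rfl, show n + 3 + 2 = n + 5 from rfl,
    show n + 2 + 1 = n + 3 from rfl, show n + 2 + 2 = n + 4 from rfl, hpk, hpk1,
    EuclideanGeometry.angle_comm (expCurve hint (p (n + 3)))]
  push_cast
  linarith
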